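/- (Theorem 1) Let 𝐒 be a random subset of {1,…,d} on the same probability space such that for every s ⊆ {1,…,d} and every value x_s with P(𝐒 = s, X_s = x_s) > 0, the conditional distribution of (X_1,…,X_d, Y) given the event {𝐒 = s, X_s = x_s} equals its conditional distribution given the event {X_s = x_s}. Define f*(s, x_s) = p(·|x_s) and v*_i(s, x_s) = I(Y; X_i | X_s = x_s) for i ∈ {1,…,d}. Then: (i) for every predictor f assigning to each pair (s, x_s) a probability mass function on 𝒴 (with the convention −log 0 = +∞), E[ℓ(f(𝐒, X_𝐒), Y)] ≥ E[ℓ(f*(𝐒, X_𝐒), Y)]; and (ii) for every value function v assigning to each pair (s, x_s) a vector in ℝ^d, E[(1/d) ∑_{i=1}^d (v_i(𝐒, X_𝐒) − Δ_i)²] ≥ E[(1/d) ∑_{i=1}^d (v*_i(𝐒, X_𝐒) − Δ_i)²], where Δ_i = ℓ(f*(𝐒, X_𝐒), Y) − ℓ(f*(𝐒 ∪ {i}, X_{𝐒∪{i}}), Y). -/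

import Mathlib

open MeasureTheory ProbabilityTheory
open scoped ENNReal NNReal

noncomputable section

variable {Ω : Type}

/-- Conditional probability of `B` given `A`, as a real number. -/
def cpr [MeasureSpace Ω] (A B : Set Ω) : ℝ :=
  (((ℙ : Measure Ω)[|A]) B).toReal

/-- Conditional expectation of `g` given the event `A`. -/
def cexp [MeasureSpace Ω] (A : Set Ω) (g : Ω → ℝ) : ℝ :=
  ∫ ω, g ω ∂((ℙ : Measure Ω)[|A])

/-- Conditional variance of `g` given the event `A`. -/
def cvar [MeasureSpace Ω] (A : Set Ω) (g : Ω → ℝ) : ℝ :=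
  variance g ((ℙ : Measure Ω)[|A])

/-- Conditional pmf of `Y` given the event `A`. -/
def cpmf {𝒴 : Type} [MeasureSpace Ω] (Y : Ω → 𝒴) (A : Set Ω) (y : 𝒴) : ℝ :=
  cpr A {ω | Y ω = y}

/-- Cross-entropy loss `ℓ(q, y) = -log q(y)`. -/
def xent {𝒴 : Type} (q : 𝒴 → ℝ) (y : 𝒴) : ℝ := -Real.log (q y)

/-- `q` is a probability mass function on the finite type `𝒴`. -/
def IsPMF {𝒴 : Type} [Fintype 𝒴] (q : 𝒴 → ℝ) : Prop :=
  (∀ y, 0 ≤ q y) ∧ ∑ y, q y = 1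

/-- Conditional entropy `H(Y | A)` of the finitely-valued `Y` on the event `A`. -/
def entropyOn {𝒴 : Type} [MeasureSpace Ω] [Fintype 𝒴] (Y : Ω → 𝒴) (A : Set Ω) : ℝ :=
  -∑ y, cpmf Y A y * Real.log (cpmf Y A y)

/-- Kullback–Leibler divergence between pmfs on a finite type. -/
def klDivFin {𝒴 : Type} [Fintype 𝒴] (p q : 𝒴 → ℝ) : ℝ :=
  ∑ y, p y * Real.log (p y / q y)

/-- Conditional mutual information `I(Y; Xi | A)` on the event `A`. -/
def cmi {𝒴 𝒳i : Type} [MeasureSpace Ω] [Fintype 𝒴] [Fintype 𝒳i]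
    (Y : Ω → 𝒴) (Xi : Ω → 𝒳i) (A : Set Ω) : ℝ :=
  entropyOn Y A - ∑ xi, cpr A {ω | Xi ω = xi} * entropyOn Y (A ∩ {ω | Xi ω = xi})

/-- The event `X_S = x_S`. -/
def evS {d : ℕ} {𝒳 : Fin d → Type} (X : ∀ i, Ω → 𝒳 i) (S : Finset (Fin d))
    (x : ∀ i, 𝒳 i) : Set Ω :=
  {ω | ∀ i ∈ S, X i ω = x i}

/-- `-log t` valued in `[0, ∞]`, with the convention `-log 0 = +∞`. -/
def negLog (t : ℝ) : ℝ≥0∞ := if t = 0 then ⊤ else ENNReal.ofReal (-Real.log t)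

/-- Discrete Gibbs inequality: the cross-entropy of `q` relative to `p` is at least the entropy
of `p`, as long as `q` charges every point charged by `p`. -/
lemma sum_mul_neg_log_le {𝒴 : Type} [Fintype 𝒴] {p q : 𝒴 → ℝ} (hp : IsPMF p) (hq : IsPMF q)
    (hpq : ∀ y, q y = 0 → p y = 0) :
    ∑ y, p y * -Real.log (p y) ≤ ∑ y, p y * -Real.log (q y) := by
  have key : ∀ y, p y * -Real.log (p y) ≤ p y * -Real.log (q y) + (q y - p y) := by
    intro y
    rcases (hp.1 y).eq_or_lt with h0 | hpos
    · simp [← h0, hq.1 y]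
    · have hqpos : 0 < q y := (hq.1 y).lt_of_ne fun h => hpos.ne' (hpq y h.symm)
      have h1 := mul_le_mul_of_nonneg_left
        (Real.log_le_sub_one_of_pos (div_pos hqpos hpos)) hpos.le
      rw [Real.log_div hqpos.ne' hpos.ne', mul_sub, mul_sub, mul_div_cancel₀ _ hpos.ne'] at h1
      linarith
  calc _ ≤ ∑ y, (p y * -Real.log (q y) + (q y - p y)) := Finset.sum_le_sum fun y _ => key y
    _ = _ := by rw [Finset.sum_add_distrib, Finset.sum_sub_distrib, hq.2, hp.2]; ring

lemma IsPMF.le_one {𝒴 : Type} [Fintype 𝒴] {p : 𝒴 → ℝ} (hp : IsPMF p) (y : 𝒴) : p y ≤ 1 :=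
  hp.2 ▸ Finset.single_le_sum (fun y _ => hp.1 y) (Finset.mem_univ y)

/-- Gibbs inequality with the convention `-log 0 = ∞`. -/
lemma sum_negLog_mul_le {𝒴 : Type} [Fintype 𝒴] {p q : 𝒴 → ℝ} (hp : IsPMF p) (hq : IsPMF q) :
    ∑ y, negLog (p y) * ENNReal.ofReal (p y) ≤ ∑ y, negLog (q y) * ENNReal.ofReal (p y) := by
  by_cases hpq : ∀ y, q y = 0 → p y = 0
  · have hterm : ∀ r : 𝒴 → ℝ, IsPMF r → (∀ y, r y = 0 → p y = 0) →
        ∑ y, negLog (r y) * ENNReal.ofReal (p y)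
          = ENNReal.ofReal (∑ y, p y * -Real.log (r y)) := by
      intro r hr hrp
      have hlog : ∀ y, 0 ≤ -Real.log (r y) := fun y =>
        neg_nonneg.2 (Real.log_nonpos (hr.1 y) (hr.le_one y))
      rw [ENNReal.ofReal_sum_of_nonneg fun y _ => mul_nonneg (hp.1 y) (hlog y)]
      refine Finset.sum_congr rfl fun y _ => ?_
      by_cases h : r y = 0
      · simp [hrp y h]
      · rw [negLog, if_neg h, mul_comm, ENNReal.ofReal_mul (hp.1 y)]
    rw [hterm p hp fun _ h => h, hterm q hq hpq]
    exact ENNReal.ofReal_le_ofReal (sum_mul_neg_log_le hp hq hpq)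
  · push Not at hpq
    obtain ⟨y, hqy, hpy⟩ := hpq
    have htop : negLog (q y) * ENNReal.ofReal (p y) = ⊤ := by
      rw [negLog, if_pos hqy, ENNReal.top_mul]
      simpa using (hp.1 y).lt_of_ne' hpy
    calc _ ≤ (⊤ : ℝ≥0∞) := le_top
      _ = negLog (q y) * ENNReal.ofReal (p y) := htop.symm
      _ ≤ _ := Finset.single_le_sum (f := fun y => negLog (q y) * ENNReal.ofReal (p y))
        (fun _ _ => zero_le) (Finset.mem_univ y)

lemma measurableSet_setOf_eq {α : Type} [MeasurableSpace Ω] [MeasurableSpace α]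
    [MeasurableSingletonClass α] {Z : Ω → α} (hZ : Measurable Z) (a : α) :
    MeasurableSet {ω | Z ω = a} :=
  hZ (measurableSet_singleton a)

lemma isPMF_real_fiber {𝒴 : Type} [Fintype 𝒴] [MeasurableSpace 𝒴] [MeasurableSingletonClass 𝒴]
    [MeasurableSpace Ω] (μ : Measure Ω) [IsProbabilityMeasure μ] {Y : Ω → 𝒴}
    (hY : Measurable Y) : IsPMF fun y => (μ {ω | Y ω = y}).toReal := by
  refine ⟨fun y => ENNReal.toReal_nonneg, ?_⟩
  rw [← ENNReal.toReal_sum fun y _ => measure_ne_top μ _]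
  have := sum_measure_preimage_singleton (μ := μ) (f := Y) Finset.univ
    fun y _ => hY (measurableSet_singleton y)
  simp only [Finset.coe_univ, Set.preimage_univ, measure_univ] at this
  rw [← ENNReal.toReal_one, ← this]
  rfl

/-- Among all pmfs, the law of `Y` minimizes the expected negative log-likelihood. -/
lemma lintegral_negLog_fiber_le {𝒴 : Type} [Fintype 𝒴] [MeasurableSpace 𝒴]
    [MeasurableSingletonClass 𝒴] [MeasurableSpace Ω] (μ : Measure Ω) [IsProbabilityMeasure μ]
    {Y : Ω → 𝒴} (hY : Measurable Y) {q : 𝒴 → ℝ} (hq : IsPMF q) :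
    ∫⁻ ω, negLog (μ {ω' | Y ω' = Y ω}).toReal ∂μ ≤ ∫⁻ ω, negLog (q (Y ω)) ∂μ := by
  have h : ∀ r : 𝒴 → ℝ, ∫⁻ ω, negLog (r (Y ω)) ∂μ
      = ∑ y, negLog (r y) * ENNReal.ofReal (μ {ω | Y ω = y}).toReal := by
    intro r
    rw [← lintegral_map (f := fun y => negLog (r y)) (measurable_of_finite _) hY,
      lintegral_fintype]
    refine Finset.sum_congr rfl fun y _ => ?_
    rw [ENNReal.ofReal_toReal (measure_ne_top μ _), Measure.map_apply hY (measurableSet_singleton y)]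
    rfl
  rw [h q, h fun y => (μ {ω | Y ω = y}).toReal]
  exact sum_negLog_mul_le (isPMF_real_fiber μ hY) hq

lemma integrable_comp_of_finite {α : Type} [Finite α] [MeasurableSpace α]
    [MeasurableSingletonClass α] [MeasurableSpace Ω] (μ : Measure Ω) [IsFiniteMeasure μ]
    {Z : Ω → α} (hZ : Measurable Z) (φ : α → ℝ) : Integrable (fun ω => φ (Z ω)) μ :=
  (Integrable.of_finite (μ := μ.map Z) (f := φ)).comp_measurable hZ

/-- The mean minimizes the expected squared error. -/
lemma integral_sq_integral_sub_le [MeasurableSpace Ω] (μ : Measure Ω) [IsProbabilityMeasure μ]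
    {D : Ω → ℝ} (hD : Integrable D μ) (hD2 : Integrable (fun ω => D ω ^ 2) μ) (c : ℝ) :
    ∫ ω, ((∫ ω', D ω' ∂μ) - D ω) ^ 2 ∂μ ≤ ∫ ω, (c - D ω) ^ 2 ∂μ := by
  have h : ∀ b : ℝ, ∫ ω, (b - D ω) ^ 2 ∂μ
      = b ^ 2 - 2 * b * (∫ ω, D ω ∂μ) + ∫ ω, D ω ^ 2 ∂μ := by
    intro b
    have : ∀ ω, (b - D ω) ^ 2 = b ^ 2 - 2 * b * D ω + D ω ^ 2 := fun ω => by ring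
    simp_rw [this]
    rw [integral_add (f := fun ω => b ^ 2 - 2 * b * D ω)
        ((integrable_const _).sub (hD.const_mul _)) hD2, integral_sub (integrable_const _) (hD.const_mul _), integral_const_mul]
    simp
  rw [h, h]
  nlinarith [sq_nonneg (c - ∫ ω, D ω ∂μ)]

/-- On the event `A`, the expected decrease of the Bayes loss caused by observing `Xi` is the
conditional mutual information. -/
lemma integral_xent_sub_xent_eq_cmi {𝒴 𝒳i : Type} [MeasureSpace Ω]
    [IsProbabilityMeasure (ℙ : Measure Ω)]
    [Fintype 𝒴] [MeasurableSpace 𝒴] [MeasurableSingletonClass 𝒴]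
    [Fintype 𝒳i] [MeasurableSpace 𝒳i] [MeasurableSingletonClass 𝒳i]
    {Y : Ω → 𝒴} {Xi : Ω → 𝒳i} (hY : Measurable Y) (hXi : Measurable Xi)
    {A : Set Ω} (hA : MeasurableSet A) :
    ∫ ω, (xent (cpmf Y A) (Y ω) - xent (cpmf Y (A ∩ {ω' | Xi ω' = Xi ω})) (Y ω))
      ∂(ℙ : Measure Ω)[|A] = cmi Y Xi A := by
  have hfirst : ∫ ω, xent (cpmf Y A) (Y ω) ∂(ℙ : Measure Ω)[|A] = entropyOn Y A := by
    rw [← integral_map (f := xent (cpmf Y A)) hY.aemeasurable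
      (measurable_of_finite _).aestronglyMeasurable, integral_fintype .of_finite, entropyOn,
      ← Finset.sum_neg_distrib]
    refine Finset.sum_congr rfl fun y _ => ?_
    rw [map_measureReal_apply hY (measurableSet_singleton y), smul_eq_mul, xent, mul_neg]
    rfl
  have hsecond : ∫ ω, xent (cpmf Y (A ∩ {ω' | Xi ω' = Xi ω})) (Y ω) ∂(ℙ : Measure Ω)[|A]
      = ∑ xi, cpr A {ω | Xi ω = xi} * entropyOn Y (A ∩ {ω | Xi ω = xi}) := by
    rw [← integral_map (φ := fun ω => (Xi ω, Y ω))
      (f := fun z : 𝒳i × 𝒴 => xent (cpmf Y (A ∩ {ω' | Xi ω' = z.1})) z.2)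
      (hXi.prodMk hY).aemeasurable (measurable_of_finite _).aestronglyMeasurable,
      integral_fintype .of_finite, Fintype.sum_prod_type]
    refine Finset.sum_congr rfl fun a _ => ?_
    rw [entropyOn, ← Finset.sum_neg_distrib, Finset.mul_sum]
    refine Finset.sum_congr rfl fun y _ => ?_
    have hpre : (fun ω => (Xi ω, Y ω)) ⁻¹' {(a, y)} = {ω | Xi ω = a} ∩ {ω | Y ω = y} := by
      ext ω; simp
    have hXa := measurableSet_setOf_eq hXi a
    have hmul : ((ℙ : Measure Ω)[|A]).real ({ω | Xi ω = a} ∩ {ω | Y ω = y})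
        = cpr A {ω | Xi ω = a} * cpmf Y (A ∩ {ω | Xi ω = a}) y := by
      rw [measureReal_def, ← cond_mul_eq_inter hXa, cond_cond_eq_cond_inter hA hXa,
        ENNReal.toReal_mul, mul_comm]
      rfl
    rw [map_measureReal_apply (hXi.prodMk hY) (measurableSet_singleton _), hpre, hmul,
      smul_eq_mul, xent]
    ring
  rw [integral_sub (integrable_comp_of_finite _ hY _)
    (integrable_comp_of_finite _ (hXi.prodMk hY)
      fun z => xent (cpmf Y (A ∩ {ω' | Xi ω' = z.1})) z.2), hfirst, hsecond, cmi]

/-- An inequality between expectations may be checked conditionally on each fiber of a finitely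
valued variable. -/
lemma lintegral_le_of_cond_fiber [MeasurableSpace Ω] (μ : Measure Ω) [IsFiniteMeasure μ]
    {κ : Type} [Finite κ] {K : Ω → κ} (hK : ∀ k, MeasurableSet (K ⁻¹' {k})) {g h : Ω → ℝ≥0∞}
    (hgh : ∀ ω₀, μ (K ⁻¹' {K ω₀}) ≠ 0 →
      ∫⁻ ω, g ω ∂μ[|K ⁻¹' {K ω₀}] ≤ ∫⁻ ω, h ω ∂μ[|K ⁻¹' {K ω₀}]) :
    ∫⁻ ω, g ω ∂μ ≤ ∫⁻ ω, h ω ∂μ := by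
  cases nonempty_fintype κ
  let _ : MeasurableSpace κ := ⊤
  have hKm : Measurable K := measurable_to_countable' hK
  rw [← sum_meas_smul_cond_fiber hKm μ, lintegral_finsetSum_measure, lintegral_finsetSum_measure]
  refine Finset.sum_le_sum fun k _ => ?_
  rw [lintegral_smul_measure, lintegral_smul_measure]
  by_cases h0 : μ (K ⁻¹' {k}) = 0
  · simp [h0]
  · obtain ⟨ω₀, rfl⟩ := nonempty_of_measure_ne_zero h0
    exact smul_le_smul_of_nonneg_left (hgh ω₀ h0) zero_le

/-- Version of `lintegral_le_of_cond_fiber` for Bochner integrals. -/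
lemma integral_le_of_cond_fiber [MeasurableSpace Ω] (μ : Measure Ω) [IsFiniteMeasure μ]
    {κ : Type} [Finite κ] {K : Ω → κ} (hK : ∀ k, MeasurableSet (K ⁻¹' {k})) {g h : Ω → ℝ}
    (hgh : ∀ ω₀, μ (K ⁻¹' {K ω₀}) ≠ 0 →
      Integrable g μ[|K ⁻¹' {K ω₀}] ∧ Integrable h μ[|K ⁻¹' {K ω₀}] ∧
      ∫ ω, g ω ∂μ[|K ⁻¹' {K ω₀}] ≤ ∫ ω, h ω ∂μ[|K ⁻¹' {K ω₀}]) :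
    ∫ ω, g ω ∂μ ≤ ∫ ω, h ω ∂μ := by
  cases nonempty_fintype κ
  let _ : MeasurableSpace κ := ⊤
  have hKm : Measurable K := measurable_to_countable' hK
  have hfib : ∀ k, Integrable g (μ (K ⁻¹' {k}) • μ[|K ⁻¹' {k}]) ∧
      Integrable h (μ (K ⁻¹' {k}) • μ[|K ⁻¹' {k}]) ∧
      ∫ ω, g ω ∂(μ (K ⁻¹' {k}) • μ[|K ⁻¹' {k}]) ≤ ∫ ω, h ω ∂(μ (K ⁻¹' {k}) • μ[|K ⁻¹' {k}]) := by
    intro k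
    by_cases h0 : μ (K ⁻¹' {k}) = 0
    · simp [h0]
    · obtain ⟨ω₀, rfl⟩ := nonempty_of_measure_ne_zero h0
      obtain ⟨hg, hh, hle⟩ := hgh ω₀ h0
      refine ⟨hg.smul_measure (measure_ne_top μ _), hh.smul_measure (measure_ne_top μ _), ?_⟩
      rw [integral_smul_measure, integral_smul_measure]
      gcongr
  rw [← sum_meas_smul_cond_fiber hKm μ,
    integral_finsetSum_measure fun k _ => (hfib k).1,
    integral_finsetSum_measure fun k _ => (hfib k).2.1]
  exact Finset.sum_le_sum fun k _ => (hfib k).2.2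

lemma measurableSet_evS [MeasurableSpace Ω] {d : ℕ} {𝒳 : Fin d → Type}
    [∀ i, MeasurableSpace (𝒳 i)] [∀ i, MeasurableSingletonClass (𝒳 i)] {X : ∀ i, Ω → 𝒳 i}
    (hX : ∀ i, Measurable (X i)) (s : Finset (Fin d)) (x : ∀ i, 𝒳 i) :
    MeasurableSet (evS X s x) := by
  have : evS X s x = ⋂ i ∈ s, {ω | X i ω = x i} := by ext; simp [evS]
  rw [this]
  exact s.measurableSet_biInter fun i _ => measurableSet_setOf_eq (hX i) _

lemma evS_congr {d : ℕ} {𝒳 : Fin d → Type} {X : ∀ i, Ω → 𝒳 i} {s : Finset (Fin d)}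
    {x x' : ∀ i, 𝒳 i} (h : ∀ i ∈ s, x i = x' i) : evS X s x = evS X s x' := by
  ext ω
  exact forall₂_congr fun i hi => by rw [h i hi]

lemma evS_insert_of_mem {d : ℕ} {𝒳 : Fin d → Type} {X : ∀ i, Ω → 𝒳 i} {s : Finset (Fin d)}
    {x : ∀ i, 𝒳 i} {ω : Ω} (hω : ω ∈ evS X s x) (i : Fin d) :
    evS X (insert i s) (fun j => X j ω) = evS X s x ∩ {ω' | X i ω' = X i ω} := by
  rw [← evS_congr (X := X) hω]
  ext ω'
  simp [evS, and_comm]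

/-- The selected index set together with the observed feature values. -/
def observation {d : ℕ} {𝒳 : Fin d → Type} (X : ∀ i, Ω → 𝒳 i) (𝒮 : Ω → Finset (Fin d)) (ω : Ω) :
    Σ s : Finset (Fin d), ∀ j : s, 𝒳 j :=
  ⟨𝒮 ω, fun j => X j ω⟩

lemma observation_fiber {d : ℕ} {𝒳 : Fin d → Type} (X : ∀ i, Ω → 𝒳 i) (𝒮 : Ω → Finset (Fin d))
    (ω₀ : Ω) : observation X 𝒮 ⁻¹' {observation X 𝒮 ω₀}
      = {ω | 𝒮 ω = 𝒮 ω₀} ∩ evS X (𝒮 ω₀) fun j => X j ω₀ := by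
  have key : ∀ (s t : Finset (Fin d)) (x y : ∀ j, 𝒳 j),
      (⟨s, fun j => x j⟩ : Σ s : Finset (Fin d), ∀ j : s, 𝒳 j) = ⟨t, fun j => y j⟩
        ↔ s = t ∧ ∀ j ∈ t, x j = y j := by
    intro s t x y
    constructor
    · intro h
      obtain rfl : s = t := congrArg Sigma.fst h
      exact ⟨rfl, fun j hj => congrFun (eq_of_heq (Sigma.mk.inj h).2) ⟨j, hj⟩⟩
    · rintro ⟨rfl, h⟩
      exact congrArg _ (funext fun j => h j j.2)
  ext ω
  exact key (𝒮 ω) (𝒮 ω₀) (fun j => X j ω) fun j => X j ω₀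

lemma measurableSet_observation_fiber [MeasurableSpace Ω] {d : ℕ} {𝒳 : Fin d → Type}
    [∀ i, MeasurableSpace (𝒳 i)] [∀ i, MeasurableSingletonClass (𝒳 i)] {X : ∀ i, Ω → 𝒳 i}
    {𝒮 : Ω → Finset (Fin d)} (hX : ∀ i, Measurable (X i))
    (h𝒮 : ∀ s, MeasurableSet {ω | 𝒮 ω = s}) (k : Σ s : Finset (Fin d), ∀ j : s, 𝒳 j) :
    MeasurableSet (observation X 𝒮 ⁻¹' {k}) := by
  by_cases hk : ∃ ω₀, observation X 𝒮 ω₀ = k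
  · obtain ⟨ω₀, rfl⟩ := hk
    rw [observation_fiber]
    exact (h𝒮 _).inter (measurableSet_evS hX _ _)
  · convert MeasurableSet.empty
    exact Set.eq_empty_of_forall_notMem fun ω hω => hk ⟨ω, hω⟩

/-- **Theorem 1.** The objectives for the predictor and the value network are jointly
optimized by the Bayes classifier `f*(s, x_s) = p(·|x_s)` and the value network
`v*_i(s, x_s) = I(Y; X_i | X_s = x_s)`. -/
theorem theorem1_joint_optimality
    [MeasureSpace Ω] [IsProbabilityMeasure (ℙ : Measure Ω)]
    {𝒴 : Type} [Fintype 𝒴] [MeasurableSpace 𝒴] [MeasurableSingletonClass 𝒴]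
    {d : ℕ} {𝒳 : Fin d → Type} [∀ i, Fintype (𝒳 i)]
    [∀ i, MeasurableSpace (𝒳 i)] [∀ i, MeasurableSingletonClass (𝒳 i)]
    (X : ∀ i, Ω → 𝒳 i) (Y : Ω → 𝒴) (𝒮 : Ω → Finset (Fin d))
    (hX : ∀ i, Measurable (X i)) (hY : Measurable Y)
    (h𝒮 : ∀ s, MeasurableSet {ω | 𝒮 ω = s})
    (hcompat : ∀ (s : Finset (Fin d)) (x : ∀ j, 𝒳 j),
      0 < (ℙ : Measure Ω) ({ω | 𝒮 ω = s} ∩ evS X s x) →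
      ∀ (x' : ∀ j, 𝒳 j) (y : 𝒴),
        ((ℙ : Measure Ω)[|{ω | 𝒮 ω = s} ∩ evS X s x]) {ω | (∀ j, X j ω = x' j) ∧ Y ω = y}
          = ((ℙ : Measure Ω)[|evS X s x]) {ω | (∀ j, X j ω = x' j) ∧ Y ω = y}) :
    -- (i) the Bayes classifier minimizes the expected cross-entropy loss, with the
    -- convention `−log 0 = +∞`
    (∀ f : Finset (Fin d) → (∀ j, 𝒳 j) → 𝒴 → ℝ,
      (∀ s x, IsPMF (f s x)) →
      (∀ s x x', (∀ j ∈ s, x j = x' j) → f s x = f s x') →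
      (∫⁻ ω, negLog (cpmf Y (evS X (𝒮 ω) (fun j => X j ω)) (Y ω)) ∂(ℙ : Measure Ω))
        ≤ ∫⁻ ω, negLog (f (𝒮 ω) (fun j => X j ω) (Y ω)) ∂(ℙ : Measure Ω))
    ∧
    -- (ii) the CMI minimizes the expected squared error against the incremental loss
    -- improvements of the Bayes classifier
    (∀ v : Finset (Fin d) → (∀ j, 𝒳 j) → Fin d → ℝ,
      (∀ s x x', (∀ j ∈ s, x j = x' j) → v s x = v s x') →
      (∫ ω, ((1 : ℝ) / d) * ∑ i, (cmi Y (X i) (evS X (𝒮 ω) (fun j => X j ω))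
            - (xent (cpmf Y (evS X (𝒮 ω) (fun j => X j ω))) (Y ω)
              - xent (cpmf Y (evS X (insert i (𝒮 ω)) (fun j => X j ω))) (Y ω))) ^ 2
          ∂(ℙ : Measure Ω))
        ≤ ∫ ω, ((1 : ℝ) / d) * ∑ i, (v (𝒮 ω) (fun j => X j ω) i
            - (xent (cpmf Y (evS X (𝒮 ω) (fun j => X j ω))) (Y ω)
              - xent (cpmf Y (evS X (insert i (𝒮 ω)) (fun j => X j ω))) (Y ω))) ^ 2
          ∂(ℙ : Measure Ω)) := by
  have hKm := measurableSet_observation_fiber hX h𝒮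
  have hXY : Measurable fun ω => ((fun j => X j ω : ∀ j, 𝒳 j), Y ω) :=
    (measurable_pi_lambda _ hX).prodMk hY
  have hlaw : ∀ (s : Finset (Fin d)) (x : ∀ j, 𝒳 j),
      (ℙ : Measure Ω) ({ω | 𝒮 ω = s} ∩ evS X s x) ≠ 0 →
      ((ℙ : Measure Ω)[|{ω | 𝒮 ω = s} ∩ evS X s x]).map (fun ω => ((fun j => X j ω), Y ω))
        = ((ℙ : Measure Ω)[|evS X s x]).map (fun ω => ((fun j => X j ω), Y ω)) := by
    intro s x h0
    refine Measure.ext_of_singleton fun z => ?_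
    rw [Measure.map_apply hXY (measurableSet_singleton z),
      Measure.map_apply hXY (measurableSet_singleton z)]
    convert hcompat s x (pos_iff_ne_zero.2 h0) z.1 z.2 using 2 <;>
    · ext ω
      simp [Prod.ext_iff, funext_iff]
  constructor
  · intro f hf hfc
    refine lintegral_le_of_cond_fiber _ hKm fun ω₀ h0 => ?_
    rw [observation_fiber] at h0 ⊢
    generalize 𝒮 ω₀ = s at *
    generalize (fun j => X j ω₀) = x at *
    have hBm := (h𝒮 s).inter (measurableSet_evS hX s x)
    have : IsProbabilityMeasure (ℙ : Measure Ω)[|{ω | 𝒮 ω = s} ∩ evS X s x] :=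
      cond_isProbabilityMeasure h0
    have hYlaw : ∀ y, ((ℙ : Measure Ω)[|{ω | 𝒮 ω = s} ∩ evS X s x]) {ω | Y ω = y}
        = ((ℙ : Measure Ω)[|evS X s x]) {ω | Y ω = y} := by
      intro y
      have hy := DFunLike.congr_fun (hlaw s x h0) (Prod.snd ⁻¹' {y})
      rwa [Measure.map_apply hXY (Set.toFinite _).measurableSet,
        Measure.map_apply hXY (Set.toFinite _).measurableSet] at hy
    have hmain := lintegral_negLog_fiber_le (ℙ : Measure Ω)[|{ω | 𝒮 ω = s} ∩ evS X s x] hY (hf s x)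
    refine (lintegral_congr_ae ?_).trans_le (hmain.trans_eq (lintegral_congr_ae ?_))
    · filter_upwards [ae_cond_mem hBm] with ω hω
      rw [show 𝒮 ω = s from hω.1, evS_congr hω.2, hYlaw]
      rfl
    · filter_upwards [ae_cond_mem hBm] with ω hω
      rw [show 𝒮 ω = s from hω.1, hfc s _ _ hω.2]
  · intro v hvc
    refine integral_le_of_cond_fiber _ hKm fun ω₀ h0 => ?_
    rw [observation_fiber] at h0 ⊢
    generalize 𝒮 ω₀ = s at *
    generalize (fun j => X j ω₀) = x at *
    have hBm := (h𝒮 s).inter (measurableSet_evS hX s x)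
    have : IsProbabilityMeasure (ℙ : Measure Ω)[|{ω | 𝒮 ω = s} ∩ evS X s x] :=
      cond_isProbabilityMeasure h0
    set ν := (ℙ : Measure Ω)[|{ω | 𝒮 ω = s} ∩ evS X s x]
    set A := evS X s x
    let δ : Fin d → (∀ j, 𝒳 j) × 𝒴 → ℝ := fun i z =>
      xent (cpmf Y A) z.2 - xent (cpmf Y (A ∩ {ω' | X i ω' = z.1 i})) z.2
    let D : Fin d → Ω → ℝ := fun i ω => δ i (fun j => X j ω, Y ω)
    have hDint : ∀ φ : (∀ j, 𝒳 j) × 𝒴 → ℝ, Integrable (fun ω => φ (fun j => X j ω, Y ω)) ν :=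
      integrable_comp_of_finite ν hXY
    have hmean : ∀ i, ∫ ω, D i ω ∂ν = cmi Y (X i) A := by
      intro i
      rw [← integral_xent_sub_xent_eq_cmi hY (hX i) (measurableSet_evS hX s x),
        ← integral_map (f := δ i) hXY.aemeasurable
          (measurable_of_finite _).aestronglyMeasurable, hlaw s x h0,
        integral_map hXY.aemeasurable (measurable_of_finite _).aestronglyMeasurable]
    have hloc : ∀ u : Finset (Fin d) → (∀ j, 𝒳 j) → Fin d → ℝ,
        (∀ x', (∀ j ∈ s, x' j = x j) → u s x' = u s x) →
        (fun ω => ((1 : ℝ) / d) * ∑ i, (u (𝒮 ω) (fun j => X j ω) i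
            - (xent (cpmf Y (evS X (𝒮 ω) (fun j => X j ω))) (Y ω)
              - xent (cpmf Y (evS X (insert i (𝒮 ω)) (fun j => X j ω))) (Y ω))) ^ 2)
          =ᵐ[ν] fun ω => ((1 : ℝ) / d) * ∑ i, (u s x i - D i ω) ^ 2 := by
      intro u hu
      filter_upwards [ae_cond_mem hBm] with ω hω
      rw [show 𝒮 ω = s from hω.1, evS_congr hω.2, hu _ hω.2]
      simp only [evS_insert_of_mem hω.2]
      rfl
    have hvloc := hloc v fun x' h => hvc s x' x h
    have hcloc := hloc (fun s x i => cmi Y (X i) (evS X s x)) fun x' h => by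
      simp only [evS_congr h]
    have hint : ∀ c : Fin d → ℝ,
        Integrable (fun ω => ((1 : ℝ) / d) * ∑ i, (c i - D i ω) ^ 2) ν := fun c =>
      hDint fun z => ((1 : ℝ) / d) * ∑ i, (c i - δ i z) ^ 2
    refine ⟨(hint _).congr hcloc.symm, (hint _).congr hvloc.symm, ?_⟩
    rw [integral_congr_ae hcloc, integral_congr_ae hvloc, integral_const_mul, integral_const_mul,
      integral_finsetSum _ fun i _ => hDint fun z => (_ - δ i z) ^ 2,
      integral_finsetSum _ fun i _ => hDint fun z => (_ - δ i z) ^ 2]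
    refine mul_le_mul_of_nonneg_left (Finset.sum_le_sum fun i _ => ?_) (by positivity)
    have hle := integral_sq_integral_sub_le ν (D := D i) (hDint (δ i))
      (hDint fun z => δ i z ^ 2) (v s x i)
    rwa [hmean] at hle
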